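/- The number of partitions π of the vertex set {1,…,2m} of the directed cycle C_{2m} (with edges (1,2),(2,3),…,(2m,1)) such that the quotient graph C_{2m}^π is a double tree equals the m-th Catalan number C_m = (1/(m+1))·binom(2m, m). For an odd cycle C_{2m+1}, no quotient C_{2m+1}^π is a double tree. -/

import Mathlib

open scoped Classical
open MeasureTheory Filter

/-- A (directed) multigraph on vertex type `V` with edge-index type `E`:
each edge `e` goes from `src e` to `tgt e`. -/
structure Multigraph (V : Type*) (E : Type*) where
  src : E → V
  tgt : E → V

namespace Multigraph

variable {V E : Type*}

/-- The underlying simple graph (forgetting orientation, multiplicity and loops). -/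
def toSimple (G : Multigraph V E) : SimpleGraph V :=
  SimpleGraph.fromRel fun v w => ∃ e, G.src e = v ∧ G.tgt e = w

/-- A multigraph is connected when its underlying simple graph is. -/
def Connected (G : Multigraph V E) : Prop := G.toSimple.Connected

/-- The unordered pair of endpoints of an edge. -/
def ends (G : Multigraph V E) (e : E) : Sym2 V := s(G.src e, G.tgt e)

/-- A multigraph is a tree when it has no loops, no multiple edges, and its
underlying simple graph is a tree (connected and acyclic). -/
def IsTree (G : Multigraph V E) : Prop :=
  G.toSimple.IsTree ∧ (∀ e, G.src e ≠ G.tgt e) ∧ Function.Injective G.ends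

/-- The number of edges having the same (unordered) endpoints as `e`. -/
noncomputable def multiplicity [Fintype E] (G : Multigraph V E) (e : E) : ℕ :=
  (Finset.univ.filter fun e' => G.ends e' = G.ends e).card

/-- A double tree: no loops, the underlying simple graph is a tree, and there are
exactly two edges between each pair of adjacent vertices. -/
def IsDoubleTree [Fintype E] (G : Multigraph V E) : Prop :=
  G.toSimple.IsTree ∧ (∀ e, G.src e ≠ G.tgt e) ∧ ∀ e, G.multiplicity e = 2

/-- The quotient multigraph obtained by identifying the vertices within each
block of the partition (setoid) `π`, keeping every edge. -/
def quot (G : Multigraph V E) (π : Setoid V) : Multigraph (Quotient π) E where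
  src e := Quotient.mk π (G.src e)
  tgt e := Quotient.mk π (G.tgt e)

end Multigraph

/-- The directed cycle on `k ≥ 1` vertices: edges `(i, i+1 mod k)` for `i = 0,…,k-1`. -/
def cycleGraph (k : ℕ) (hk : 0 < k) : Multigraph (Fin k) (Fin k) where
  src := id
  tgt i := ⟨(i.1 + 1) % k, Nat.mod_lt _ hk⟩

namespace CycleDT

/-- `h` is a height function of a Dyck path of length `n`. -/
structure IsDyck (n : ℕ) (h : ℕ → ℕ) : Prop where
  zero : h 0 = 0
  last : h n = 0
  step : ∀ i, i < n → h (i + 1) = h i + 1 ∨ h i = h (i + 1) + 1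

/-- Two times visit the same vertex of the plane tree coded by `h`. -/
def Rel (h : ℕ → ℕ) (i j : ℕ) : Prop :=
  h i = h j ∧ ∀ k, (i ≤ k ∧ k ≤ j) ∨ (j ≤ k ∧ k ≤ i) → h i ≤ h k

lemma Rel.refl (h : ℕ → ℕ) (i : ℕ) : Rel h i i := by
  refine ⟨rfl, fun k hk => ?_⟩
  have : k = i := by omega
  rw [this]

lemma Rel.symm {h : ℕ → ℕ} {i j : ℕ} (H : Rel h i j) : Rel h j i := by
  refine ⟨H.1.symm, fun k hk => ?_⟩
  have := H.2 k (by omega)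
  have := H.1
  omega

lemma Rel.trans {h : ℕ → ℕ} {i j k : ℕ} (H : Rel h i j) (H' : Rel h j k) : Rel h i k := by
  refine ⟨H.1.trans H'.1, fun l hl => ?_⟩
  have h1 := H.1
  by_cases hc : (i ≤ l ∧ l ≤ j) ∨ (j ≤ l ∧ l ≤ i)
  · exact H.2 l hc
  · have := H'.2 l (by omega)
    omega

lemma first_drop {n : ℕ} {h : ℕ → ℕ} (H : IsDyck n h) (L i j : ℕ) (hij : i ≤ j) (hj : j ≤ n)
    (hi : L ≤ h i) (hjL : h j < L) :
    ∃ k, i ≤ k ∧ k < j ∧ h k = L ∧ h (k + 1) + 1 = L ∧ ∀ l, i ≤ l → l ≤ k → L ≤ h l := by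
  induction j, hij using Nat.le_induction with
  | base => omega
  | succ j hij ih =>
    by_cases hc : h j < L
    · obtain ⟨k, h1, h2, h3⟩ := ih (by omega) hc
      exact ⟨k, h1, by omega, h3⟩
    · have := H.step j (by omega)
      by_cases hd : ∃ l, i ≤ l ∧ l ≤ j ∧ h l < L
      · obtain ⟨l, hl1, hl2, hl3⟩ := hd
        -- strong form: use the first such `l`
        have hex : ∃ l, i ≤ l ∧ h l < L := ⟨l, hl1, hl3⟩
        have hs := Nat.find_spec hex
        have hmin := fun t (ht : t < Nat.find hex) => Nat.find_min hex ht
        have hle : Nat.find hex ≤ l := Nat.find_min' hex ⟨hl1, hl3⟩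
        set t := Nat.find hex
        have hti : t ≠ i := by rintro hh; rw [hh] at hs; omega
        have h1 := hmin (t - 1) (by omega)
        have h2 := H.step (t - 1) (by omega)
        have h3 : t - 1 + 1 = t := by omega
        rw [h3] at h2
        refine ⟨t - 1, by omega, by omega, by omega, by rw [h3]; omega, fun s hs1 hs2 => ?_⟩
        have := hmin s (by omega)
        omega
      · push Not at hd
        exact ⟨j, hij, by omega, by omega, by omega, hd⟩

lemma last_rise {n : ℕ} {h : ℕ → ℕ} (H : IsDyck n h) (L i j : ℕ) (hij : i ≤ j) (hj : j ≤ n)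
    (hi : h i < L) (hjL : L ≤ h j) :
    ∃ k, i ≤ k ∧ k < j ∧ h k + 1 = L ∧ h (k + 1) = L ∧ ∀ l, k + 1 ≤ l → l ≤ j → L ≤ h l := by
  induction j, hij using Nat.le_induction with
  | base => omega
  | succ j hij ih =>
    have := H.step j (by omega)
    by_cases hc : h j < L
    · refine ⟨j, hij, by omega, by omega, by omega, fun l h1 h2 => ?_⟩
      have : l = j + 1 := by omega
      subst this; omega
    · obtain ⟨k, h1, h2, h3, h4, h5⟩ := ih (by omega) (by omega)
      refine ⟨k, h1, by omega, h3, h4, fun l hl1 hl2 => ?_⟩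
      rcases Nat.lt_or_ge j l with hh | hh
      · have : l = j + 1 := by omega
        subst this; omega
      · exact h5 l hl1 hh

lemma unique_parent {V : Type*} {G : SimpleGraph V} (hG : G.IsTree) (r u u' v : V)
    (h1 : G.Adj u v) (h2 : G.Adj u' v) (h3 : G.dist r u + 1 = G.dist r v)
    (h4 : G.dist r u' + 1 = G.dist r v) : u = u' := by
  obtain ⟨p, hp, hpl⟩ := hG.connected.exists_path_of_dist r u
  obtain ⟨p', hp', hpl'⟩ := hG.connected.exists_path_of_dist r u'
  have a1 : (p.concat h1).IsPath := SimpleGraph.Walk.isPath_of_length_eq_dist _ (by simp; omega)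
  have a2 : (p'.concat h2).IsPath := SimpleGraph.Walk.isPath_of_length_eq_dist _ (by simp; omega)
  have := (hG.existsUnique_path r v).unique a1 a2
  have := congrArg SimpleGraph.Walk.penultimate this
  simpa using this

lemma acyclic_of_height {V : Type*} {G : SimpleGraph V} (f : V → ℕ)
    (hf : ∀ u v, G.Adj u v → f u = f v + 1 ∨ f v = f u + 1)
    (hu : ∀ u u' v, G.Adj u v → G.Adj u' v → f u + 1 = f v → f u' + 1 = f v → u = u') :
    G.IsAcyclic := by
  intro v c hc
  obtain ⟨w, hw, hmax⟩ := c.support.toFinset.exists_max_image f ⟨v, by simp⟩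
  simp only [List.mem_toFinset] at hw hmax
  have hc' := hc.rotate hw
  set d := c.rotate _ hw with hd
  have hnn : ¬ d.Nil := hc'.not_nil
  have hsub : ∀ x ∈ d.support, f x ≤ f w := by
    intro x hx
    exact hmax x (by simpa [hd] using hx)
  have a1 := (d.adj_snd hnn).symm
  have a2 := d.adj_penultimate hnn
  have b1 := hsub d.snd (SimpleGraph.Walk.getVert_mem_support _ _)
  have b2 := hsub d.penultimate (SimpleGraph.Walk.getVert_mem_support _ _)
  have e1 := hf _ _ a1
  have e2 := hf _ _ a2
  exact hc'.snd_ne_penultimate (hu _ _ _ a1 a2 (by omega) (by omega))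

/-- The vertex of the quotient visited at time `i`. -/
def q {n : ℕ} (hn : 0 < n) (π : Setoid (Fin n)) (i : ℕ) : Quotient π :=
  Quotient.mk π ⟨i % n, Nat.mod_lt _ hn⟩

section
variable {n : ℕ} (hn : 0 < n) (π : Setoid (Fin n))

lemma mult_eq_card {V E : Type*} [Fintype E] (G : Multigraph V E) (e : E)
    [DecidablePred fun e' => G.ends e' = G.ends e] :
    (Finset.univ.filter fun e' => G.ends e' = G.ends e).card = G.multiplicity e := by
  rw [Multigraph.multiplicity]
  congr

lemma src_eq (e : Fin n) : ((cycleGraph n hn).quot π).src e = q hn π e := by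
  simp only [Multigraph.quot, cycleGraph, q, id]
  congr 1
  ext
  simp [Nat.mod_eq_of_lt e.2]

lemma tgt_eq (e : Fin n) : ((cycleGraph n hn).quot π).tgt e = q hn π (e + 1) := rfl

lemma ends_eq (e : Fin n) :
    ((cycleGraph n hn).quot π).ends e = s(q hn π e, q hn π (e + 1)) := by
  rw [Multigraph.ends, src_eq, tgt_eq]

lemma q_surj (x : Quotient π) : ∃ i, i < n ∧ q hn π i = x := by
  induction x using Quotient.inductionOn with
  | h a =>
    refine ⟨a, a.2, ?_⟩
    simp only [q]
    congr 1
    ext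
    simp [Nat.mod_eq_of_lt a.2]

lemma q_last : q hn π n = q hn π 0 := by simp [q]

lemma adj_iff (u v : Quotient π) : ((cycleGraph n hn).quot π).toSimple.Adj u v ↔
    u ≠ v ∧ ∃ e, e < n ∧ ((q hn π e = u ∧ q hn π (e + 1) = v) ∨
      (q hn π e = v ∧ q hn π (e + 1) = u)) := by
  rw [Multigraph.toSimple, SimpleGraph.fromRel_adj]
  refine and_congr_right fun _ => ?_
  simp only [src_eq, tgt_eq]
  constructor
  · rintro (⟨e, h⟩ | ⟨e, h⟩)
    · exact ⟨e, e.2, Or.inl h⟩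
    · exact ⟨e, e.2, Or.inr h⟩
  · rintro ⟨e, he, h | h⟩
    · exact Or.inl ⟨⟨e, he⟩, h⟩
    · exact Or.inr ⟨⟨e, he⟩, h⟩

lemma q_rel (i j : ℕ) (hi : i < n) (hj : j < n) :
    q hn π i = q hn π j ↔ π ⟨i, hi⟩ ⟨j, hj⟩ := by
  simp only [q, Nat.mod_eq_of_lt hi, Nat.mod_eq_of_lt hj]
  exact Quotient.eq

end

/-- The height function attached to a quotient. -/
noncomputable def ht {n : ℕ} (hn : 0 < n) (π : Setoid (Fin n)) (i : ℕ) : ℕ :=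
  ((cycleGraph n hn).quot π).toSimple.dist (q hn π 0) (q hn π i)

section
variable {n : ℕ} {hn : 0 < n} {π : Setoid (Fin n)}

lemma adj_q (H : ((cycleGraph n hn).quot π).IsDoubleTree) (i : ℕ) (hi : i < n) :
    ((cycleGraph n hn).quot π).toSimple.Adj (q hn π i) (q hn π (i + 1)) := by
  rw [adj_iff]
  refine ⟨?_, i, hi, Or.inl ⟨rfl, rfl⟩⟩
  have := H.2.1 ⟨i, hi⟩
  rwa [src_eq, tgt_eq] at this

lemma ht_isDyck (H : ((cycleGraph n hn).quot π).IsDoubleTree) : IsDyck n (ht hn π) where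
  zero := by simp [ht]
  last := by simp [ht, q_last]
  step i hi := by
    have := H.1.dist_eq_dist_add_one_of_adj (q hn π 0) (adj_q H i hi)
    simp only [ht]
    omega

lemma q_eq_of_rel (H : ((cycleGraph n hn).quot π).IsDoubleTree) (d : ℕ) :
    ∀ i j, j = i + d → j ≤ n → ht hn π i = ht hn π j →
      (∀ k, i ≤ k → k ≤ j → ht hn π i ≤ ht hn π k) → q hn π i = q hn π j := by
  have HD := ht_isDyck H
  induction d using Nat.strong_induction_on with
  | _ d ih =>
  intro i j hd hj he hk
  rcases Nat.eq_zero_or_pos d with h0 | hpos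
  · subst h0; simp [hd]
  by_cases hc : ∃ k, i < k ∧ k < j ∧ ht hn π k = ht hn π i
  · obtain ⟨k, h1, h2, h3⟩ := hc
    have e1 := ih (k - i) (by omega) i k (by omega) (by omega) h3.symm
      (fun l hl1 hl2 => hk l hl1 (by omega))
    have e2 := ih (j - k) (by omega) k j (by omega) (by omega) (by omega)
      (fun l hl1 hl2 => by rw [h3]; exact hk l (by omega) hl2)
    exact e1.trans e2
  · push Not at hc
    have s1 := HD.step i (by omega)
    have s2 := HD.step (j - 1) (by omega)
    have hj1 : j - 1 + 1 = j := by omega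
    rw [hj1] at s2
    have k1 := hk (i + 1) (by omega) (by omega)
    have k2 := hk (j - 1) (by omega) (by omega)
    have hne : i + 1 ≠ j := by rintro rfl; omega
    have e1 := ih (d - 2) (by omega) (i + 1) (j - 1) (by omega) (by omega) (by omega)
      (fun l hl1 hl2 => by
        have := hk l (by omega) (by omega)
        have := hc l (by omega) (by omega)
        omega)
    have a1 := adj_q H i (by omega)
    have a2 := adj_q H (j - 1) (by omega)
    rw [hj1, ← e1] at a2
    refine unique_parent H.1 (q hn π 0) _ _ _ a1 a2.symm ?_ ?_
    · change ht hn π i + 1 = ht hn π (i + 1)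
      omega
    · change ht hn π j + 1 = ht hn π (i + 1)
      omega

lemma q_eq_of_rel' (H : ((cycleGraph n hn).quot π).IsDoubleTree) (i j : ℕ) (hi : i ≤ n)
    (hj : j ≤ n) (h : Rel (ht hn π) i j) : q hn π i = q hn π j := by
  rcases le_total i j with hij | hij
  · exact q_eq_of_rel H (j - i) i j (by omega) hj h.1 (fun k h1 h2 => h.2 k (by omega))
  · exact (q_eq_of_rel H (i - j) j i (by omega) hi h.1.symm
      (fun k h1 h2 => by rw [← h.1]; exact h.2 k (by omega))).symm

lemma rel_of_q_eq_lt (H : ((cycleGraph n hn).quot π).IsDoubleTree) (i j : ℕ) (hij : i < j)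
    (hj : j < n) (h : q hn π i = q hn π j) : Rel (ht hn π) i j := by
  have HD := ht_isDyck H
  have he : ht hn π i = ht hn π j := by simp only [ht, h]
  refine ⟨he, ?_⟩
  by_contra hcon
  push Not at hcon
  obtain ⟨k, hk, hlt⟩ := hcon
  obtain ⟨a, a1, a2, a3, a4, a5⟩ :=
    first_drop HD (ht hn π i) i k (by omega) (by omega) le_rfl hlt
  obtain ⟨b, b1, b2, b3, b4, b5⟩ :=
    last_rise HD (ht hn π i) k j (by omega) (by omega) hlt he.le
  obtain ⟨c, c1, c2, c3, c4, c5⟩ :=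
    last_rise HD (ht hn π i) 0 i (by omega) (by omega) (by rw [HD.zero]; omega) le_rfl
  have ea : q hn π i = q hn π a :=
    q_eq_of_rel' H i a (by omega) (by omega) ⟨a3.symm, fun l hl => a5 l (by omega) (by omega)⟩
  have eb : q hn π (b + 1) = q hn π j :=
    q_eq_of_rel' H (b + 1) j (by omega) (by omega)
      ⟨by omega, fun l hl => by rw [b4]; exact b5 l (by omega) (by omega)⟩
  have ec : q hn π (c + 1) = q hn π i :=
    q_eq_of_rel' H (c + 1) i (by omega) (by omega)
      ⟨by omega, fun l hl => by rw [c4]; exact c5 l (by omega) (by omega)⟩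
  have Aa := adj_q H a (by omega)
  have Ab := adj_q H b (by omega)
  have Ac := adj_q H c (by omega)
  rw [← ea] at Aa
  rw [eb, ← h] at Ab
  rw [ec] at Ac
  have u1 : q hn π b = q hn π (a + 1) := unique_parent H.1 (q hn π 0) _ _ _ Ab Aa.symm b3 a4
  have u2 : q hn π c = q hn π (a + 1) := unique_parent H.1 (q hn π 0) _ _ _ Ac Aa.symm c3 a4
  have hmul := H.2.2 ⟨a, by omega⟩
  have hsub : ({⟨a, by omega⟩, ⟨b, by omega⟩, ⟨c, by omega⟩} : Finset (Fin n)) ⊆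
      Finset.univ.filter fun e' => ((cycleGraph n hn).quot π).ends e' =
        ((cycleGraph n hn).quot π).ends ⟨a, by omega⟩ := by
    intro x hx
    simp only [Finset.mem_insert, Finset.mem_singleton] at hx
    simp only [Finset.mem_filter, Finset.mem_univ, true_and, ends_eq]
    rcases hx with rfl | rfl | rfl
    · rfl
    · simp only [u1, eb, ← h, ← ea]; exact Sym2.eq_swap
    · simp only [u2, ec, ← ea]; exact Sym2.eq_swap
  have hcard := Finset.card_le_card hsub
  rw [mult_eq_card, hmul, Finset.card_insert_of_notMem, Finset.card_insert_of_notMem,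
    Finset.card_singleton] at hcard
  · omega
  · simp; omega
  · simp; omega

lemma q_eq_iff_rel (H : ((cycleGraph n hn).quot π).IsDoubleTree) (i j : ℕ) (hi : i < n)
    (hj : j < n) : q hn π i = q hn π j ↔ Rel (ht hn π) i j := by
  constructor
  · intro h
    rcases lt_trichotomy i j with hij | rfl | hij
    · exact rel_of_q_eq_lt H i j hij hj h
    · exact Rel.refl _ _
    · exact (rel_of_q_eq_lt H j i hij hi h.symm).symm
  · exact q_eq_of_rel' H i j hi.le hj.le

end

/-- The partition attached to a height function. -/
def toSetoid (n : ℕ) (h : ℕ → ℕ) : Setoid (Fin n) where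
  r i j := Rel h i j
  iseqv := ⟨fun i => Rel.refl h i, fun H => H.symm, fun H H' => H.trans H'⟩

section
variable {n : ℕ} {hn : 0 < n} {h : ℕ → ℕ}

lemma rel_last (H : IsDyck n h) : Rel h n 0 :=
  ⟨by rw [H.zero, H.last], fun k _ => by rw [H.last]; omega⟩

lemma rel_mod (H : IsDyck n h) (i : ℕ) (hi : i ≤ n) : Rel h i (i % n) := by
  rcases hi.lt_or_eq with h1 | rfl
  · rw [Nat.mod_eq_of_lt h1]; exact Rel.refl _ _
  · rw [Nat.mod_self]; exact rel_last H

lemma q_toSetoid (H : IsDyck n h) (i j : ℕ) (hi : i ≤ n) (hj : j ≤ n) :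
    q hn (toSetoid n h) i = q hn (toSetoid n h) j ↔ Rel h i j := by
  rw [q, q, Quotient.eq]
  change Rel h (i % n) (j % n) ↔ _
  have h1 := rel_mod H i hi
  have h2 := rel_mod H j hj
  exact ⟨fun h3 => h1.trans (h3.trans h2.symm), fun h3 => h1.symm.trans (h3.trans h2)⟩

/-- Height of a vertex in the quotient. -/
def qht (n : ℕ) (h : ℕ → ℕ) : Quotient (toSetoid n h) → ℕ :=
  Quotient.lift (fun i => h i) (fun _ _ hab => hab.1)

lemma qht_q (H : IsDyck n h) (i : ℕ) (hi : i ≤ n) : qht n h (q hn (toSetoid n h) i) = h i :=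
  (rel_mod H i hi).1.symm

lemma rel_parent (a b a' b' : ℕ) (hab : a = b + 1 ∨ b = a + 1)
    (hab' : a' = b' + 1 ∨ b' = a' + 1) (h1 : h a + 1 = h b) (h2 : h a' + 1 = h b')
    (hb : Rel h b b') : Rel h a a' := by
  have := hb.1
  refine ⟨by omega, fun k hk => ?_⟩
  by_cases hc : (b ≤ k ∧ k ≤ b') ∨ (b' ≤ k ∧ k ≤ b)
  · have := hb.2 k hc
    omega
  · have : k = a ∨ k = a' := by omega
    rcases this with rfl | rfl <;> omega

lemma mult_up (H : IsDyck n h) (e : ℕ) (he : e < n) (hup : h (e + 1) = h e + 1) :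
    ((cycleGraph n hn).quot (toSetoid n h)).multiplicity ⟨e, he⟩ = 2 := by
  obtain ⟨f, f1, f2, f3, f4, f5⟩ := first_drop H (h e + 1) (e + 1) n (by omega) le_rfl (by omega)
    (by rw [H.last]; omega)
  have r1 : Rel h (e + 1) f := ⟨by omega, fun k hk => by rw [hup]; exact f5 k (by omega) (by omega)⟩
  have r2 : Rel h e (f + 1) :=
    rel_parent e (e + 1) (f + 1) f (by omega) (by omega) (by omega) (by omega) r1
  have : (Finset.univ.filter fun e' => ((cycleGraph n hn).quot (toSetoid n h)).ends e' =
      ((cycleGraph n hn).quot (toSetoid n h)).ends ⟨e, he⟩) = {⟨e, he⟩, ⟨f, f2⟩} := by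
    ext ⟨g, hg⟩
    simp only [Finset.mem_filter, Finset.mem_univ, true_and, ends_eq, Finset.mem_insert,
      Finset.mem_singleton, Fin.mk.injEq, Sym2.eq_iff]
    rw [q_toSetoid H _ _ (by omega) (by omega), q_toSetoid H _ _ (by omega) (by omega),
      q_toSetoid H _ _ (by omega) (by omega), q_toSetoid H _ _ (by omega) (by omega)]
    constructor
    · rintro (⟨g1, g2⟩ | ⟨g1, g2⟩)
      · left
        by_contra hne
        have x1 := g1.1
        have x2 := g2.1
        rcases Nat.lt_or_ge g e with hlt | hge
        · have := g2.2 e (by omega)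
          omega
        · have := g2.2 g (by omega)
          omega
      · right
        have x1 := g1.1
        have x2 := g2.1
        have hge : e < g := by
          by_contra hcon
          have := g1.2 e (by omega)
          omega
        by_contra hne
        have g3 := g1.trans r1
        rcases Nat.lt_or_ge g f with hlt | hge
        · have := g3.2 (g + 1) (by omega)
          omega
        · have := g3.2 (f + 1) (by omega)
          omega
    · rintro (rfl | rfl)
      · exact Or.inl ⟨Rel.refl _ _, Rel.refl _ _⟩
      · exact Or.inr ⟨r1.symm, r2.symm⟩
  rw [← mult_eq_card, this, Finset.card_pair]
  simp; omega

lemma mult_two (H : IsDyck n h) (e : Fin n) :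
    ((cycleGraph n hn).quot (toSetoid n h)).multiplicity e = 2 := by
  obtain ⟨e, he⟩ := e
  rcases H.step e he with hup | hdown
  · exact mult_up H e he hup
  · obtain ⟨f, f1, f2, f3, f4, f5⟩ := last_rise H (h e) 0 e (by omega) (by omega)
      (by rw [H.zero]; omega) le_rfl
    have r1 : Rel h (f + 1) e := ⟨f4, fun k hk => by rw [f4]; exact f5 k (by omega) (by omega)⟩
    have r2 : Rel h f (e + 1) :=
      rel_parent f (f + 1) (e + 1) e (by omega) (by omega) (by omega) (by omega) r1
    rw [← mult_up (hn := hn) H f (by omega) (by omega)]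
    have : ((cycleGraph n hn).quot (toSetoid n h)).ends ⟨e, he⟩ =
        ((cycleGraph n hn).quot (toSetoid n h)).ends ⟨f, by omega⟩ := by
      simp only [ends_eq]
      rw [(q_toSetoid (hn := hn) H _ _ (by omega) (by omega)).2 r1,
        (q_toSetoid (hn := hn) H _ _ (by omega) (by omega)).2 r2]
      exact Sym2.eq_swap
    rw [Multigraph.multiplicity, Multigraph.multiplicity, this]

lemma isDoubleTree (H : IsDyck n h) :
    ((cycleGraph n hn).quot (toSetoid n h)).IsDoubleTree := by
  have hne : ∀ i, i < n → q hn (toSetoid n h) i ≠ q hn (toSetoid n h) (i + 1) := by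
    intro i hi hcon
    rw [q_toSetoid H _ _ (by omega) (by omega)] at hcon
    have := hcon.1
    have := H.step i hi
    omega
  refine ⟨⟨?_, ?_⟩, fun e => ?_, mult_two H⟩
  · have hr : ∀ i, i ≤ n → ((cycleGraph n hn).quot (toSetoid n h)).toSimple.Reachable
        (q hn (toSetoid n h) 0) (q hn (toSetoid n h) i) := by
      intro i
      induction i with
      | zero => intro _; exact SimpleGraph.Reachable.refl _
      | succ i ih =>
        intro hi
        refine (ih (by omega)).trans (SimpleGraph.Adj.reachable ?_)
        rw [adj_iff]
        exact ⟨hne i (by omega), i, by omega, Or.inl ⟨rfl, rfl⟩⟩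
    have : Nonempty (Quotient (toSetoid n h)) := ⟨q hn _ 0⟩
    refine SimpleGraph.Connected.mk fun u v => ?_
    obtain ⟨i, hi, rfl⟩ := q_surj hn _ u
    obtain ⟨j, hj, rfl⟩ := q_surj hn _ v
    exact (hr i hi.le).symm.trans (hr j hj.le)
  · have key : ∀ u v, ((cycleGraph n hn).quot (toSetoid n h)).toSimple.Adj u v →
        ∃ a b, a ≤ n ∧ b ≤ n ∧ (a = b + 1 ∨ b = a + 1) ∧ q hn _ a = u ∧ q hn _ b = v ∧
          (h a = h b + 1 ∨ h b = h a + 1) := by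
      intro u v huv
      rw [adj_iff] at huv
      obtain ⟨_, e, he, h1 | h1⟩ := huv
      · exact ⟨e, e + 1, by omega, by omega, by omega, h1.1, h1.2, (H.step e he).symm⟩
      · exact ⟨e + 1, e, by omega, by omega, by omega, h1.2, h1.1, H.step e he⟩
    refine acyclic_of_height (qht n h) ?_ ?_
    · intro u v huv
      obtain ⟨a, b, ha, hb, hab, rfl, rfl, hh⟩ := key u v huv
      rwa [qht_q H a ha, qht_q H b hb]
    · intro u u' v huv huv' h1 h2
      obtain ⟨a, b, ha, hb, hab, rfl, rfl, hh⟩ := key u v huv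
      obtain ⟨a', b', ha', hb', hab', rfl, h3, hh'⟩ := key u' _ huv'
      rw [← h3, qht_q H a' ha', qht_q H b' hb'] at h2
      rw [qht_q H a ha, qht_q H b hb] at h1
      rw [q_toSetoid H _ _ hb' hb] at h3
      rw [q_toSetoid H _ _ ha ha']
      exact rel_parent a b a' b' hab hab' h1 h2 h3.symm
  · rw [src_eq, tgt_eq]
    exact hne e e.2

/-- The step at time `i` goes up iff time `i+1` visits a new vertex. -/
lemma up_iff (H : IsDyck n h) (i : ℕ) (hi : i < n) :
    h (i + 1) = h i + 1 ↔ ∀ j, j ≤ i → ¬ Rel h j (i + 1) := by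
  constructor
  · intro hup j hj hr
    have := hr.2 i (by omega)
    have := hr.1
    omega
  · intro hall
    rcases H.step i hi with hup | hdown
    · exact hup
    · exfalso
      obtain ⟨f, f1, f2, f3, f4, f5⟩ := last_rise H (h i) 0 i (by omega) (by omega)
        (by rw [H.zero]; omega) le_rfl
      have r1 : Rel h (f + 1) i := ⟨f4, fun k hk => by rw [f4]; exact f5 k (by omega) (by omega)⟩
      exact hall f (by omega)
        (rel_parent f (f + 1) (i + 1) i (by omega) (by omega) (by omega) (by omega) r1)

end

lemma toSetoid_inj {n : ℕ} (hn : 0 < n) {h h' : ℕ → ℕ} (H : IsDyck n h) (H' : IsDyck n h')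
    (he : toSetoid n h = toSetoid n h') (i : ℕ) (hi : i ≤ n) : h i = h' i := by
  have hrel : ∀ i j, i ≤ n → j ≤ n → (Rel h i j ↔ Rel h' i j) := by
    intro i j hi hj
    rw [← q_toSetoid (hn := hn) H i j hi hj, ← q_toSetoid (hn := hn) H' i j hi hj, he]
  induction i with
  | zero => rw [H.zero, H'.zero]
  | succ i ih =>
    have e := ih (by omega)
    have u : h (i + 1) = h i + 1 ↔ h' (i + 1) = h' i + 1 := by
      rw [up_iff H i (by omega), up_iff H' i (by omega)]
      exact forall_congr' fun j => forall_congr' fun hj =>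
        not_congr (hrel j (i + 1) (by omega) hi)
    have s := H.step i (by omega)
    have s' := H'.step i (by omega)
    omega

lemma exists_dyck {n : ℕ} (hn : 0 < n) (π : Setoid (Fin n))
    (H : ((cycleGraph n hn).quot π).IsDoubleTree) : ∃ h, IsDyck n h ∧ toSetoid n h = π := by
  refine ⟨ht hn π, ht_isDyck H, ?_⟩
  ext ⟨i, hi⟩ ⟨j, hj⟩
  rw [← q_rel hn π i j hi hj, q_eq_iff_rel H i j hi hj]
  rfl

open DyckStep in
/-- Height function of a Dyck word. -/
def wh (w : DyckWord) (i : ℕ) : ℕ := (w.toList.take i).count U - (w.toList.take i).count D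

open DyckStep in
lemma wh_step (w : DyckWord) (i : ℕ) (hi : i < w.toList.length) :
    (w.toList[i] = U ∧ wh w (i + 1) = wh w i + 1) ∨
      (w.toList[i] = D ∧ wh w i = wh w (i + 1) + 1) := by
  have h1 := w.count_D_le_count_U i
  have h2 := w.count_D_le_count_U (i + 1)
  simp only [wh]
  rw [List.take_succ_eq_append_getElem hi] at h2 ⊢
  rcases DyckStep.dichotomy w.toList[i] with h | h
  · left
    simp [h] at h2 ⊢
    omega
  · right
    simp [h] at h2 ⊢
    omega

lemma wh_isDyck (w : DyckWord) (m : ℕ) (hw : w.semilength = m) : IsDyck (2 * m) (wh w) where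
  zero := by simp [wh]
  last := by
    rw [← hw, DyckWord.two_mul_semilength_eq_length, wh, List.take_length,
      w.count_U_eq_count_D, Nat.sub_self]
  step i hi := by
    rw [← hw, DyckWord.two_mul_semilength_eq_length] at hi
    rcases wh_step w i hi with h | h
    · exact Or.inl h.2
    · exact Or.inr h.2

lemma wh_inj (m : ℕ) (w w' : DyckWord) (hw : w.semilength = m) (hw' : w'.semilength = m)
    (h : ∀ i ≤ 2 * m, wh w i = wh w' i) : w = w' := by
  have l1 := w.two_mul_semilength_eq_length
  have l2 := w'.two_mul_semilength_eq_length
  ext1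
  refine List.ext_getElem (by omega) fun i h1 h2 => ?_
  have e1 := h i (by omega)
  have e2 := h (i + 1) (by omega)
  rcases wh_step w i h1 with a | a <;> rcases wh_step w' i h2 with b | b
  · rw [a.1, b.1]
  · omega
  · omega
  · rw [a.1, b.1]

open DyckStep in
/-- Step list of a height function. -/
noncomputable def steps (h : ℕ → ℕ) (n : ℕ) : List DyckStep :=
  (List.range n).map fun i => if h (i + 1) = h i + 1 then U else D

open DyckStep in
lemma count_steps {n : ℕ} {h : ℕ → ℕ} (H : IsDyck n h) (k : ℕ) (hk : k ≤ n) :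
    (steps h k).count U = (steps h k).count D + h k := by
  induction k with
  | zero => simp [steps, H.zero]
  | succ k ih =>
    have e := ih (by omega)
    have s := H.step k (by omega)
    simp only [steps, List.range_succ, List.map_append, List.map_cons, List.map_nil,
      List.count_append] at e ⊢
    by_cases hc : h (k + 1) = h k + 1
    · simp [hc]; omega
    · simp [hc]; omega

lemma take_steps (h : ℕ → ℕ) (n i : ℕ) : (steps h n).take i = steps h (min i n) := by
  simp [steps, ← List.map_take, List.take_range]

lemma exists_word {m : ℕ} {h : ℕ → ℕ} (H : IsDyck (2 * m) h) :
    ∃ w : DyckWord, w.semilength = m ∧ ∀ i ≤ 2 * m, wh w i = h i := by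
  let w : DyckWord := ⟨steps h (2 * m), by
    rw [count_steps H _ le_rfl, H.last, Nat.add_zero], fun i => by
    rw [take_steps, count_steps H _ (min_le_right _ _)]; omega⟩
  refine ⟨w, ?_, fun i hi => ?_⟩
  · have := w.two_mul_semilength_eq_length
    have h2 : w.toList.length = 2 * m := by simp [w, steps]
    omega
  · simp only [wh, w]
    rw [take_steps, count_steps H _ (min_le_right _ _), min_eq_left hi]
    omega

lemma toSetoid_congr {n : ℕ} {h h' : ℕ → ℕ} (he : ∀ i ≤ n, h i = h' i) :
    toSetoid n h = toSetoid n h' := by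
  ext ⟨i, hi⟩ ⟨j, hj⟩
  change Rel h i j ↔ Rel h' i j
  simp only [Rel]
  rw [he i hi.le, he j hj.le]
  refine and_congr_right fun _ => forall_congr' fun k => ?_
  constructor
  · intro a b; rw [← he k (by omega)]; exact a b
  · intro a b; rw [he k (by omega)]; exact a b

lemma card_eq (m : ℕ) (hm : 0 < 2 * m) :
    Nat.card {π : Setoid (Fin (2 * m)) // ((cycleGraph (2 * m) hm).quot π).IsDoubleTree}
      = catalan m := by
  rw [← DyckWord.card_dyckWord_semilength_eq_catalan, ← Nat.card_eq_fintype_card]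
  symm
  refine Nat.card_eq_of_bijective
    (fun w : {w : DyckWord // w.semilength = m} =>
      (⟨toSetoid (2 * m) (wh w.1), isDoubleTree (wh_isDyck w.1 m w.2)⟩ :
        {π : Setoid (Fin (2 * m)) // ((cycleGraph (2 * m) hm).quot π).IsDoubleTree})) ⟨?_, ?_⟩
  · rintro ⟨w, hw⟩ ⟨w', hw'⟩ he
    simp only [Subtype.mk.injEq] at he ⊢
    exact wh_inj m w w' hw hw'
      (fun i hi => toSetoid_inj hm (wh_isDyck w m hw) (wh_isDyck w' m hw') he i hi)
  · rintro ⟨π, hπ⟩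
    obtain ⟨h, H, rfl⟩ := exists_dyck hm π hπ
    obtain ⟨w, hw, hwh⟩ := exists_word H
    refine ⟨⟨w, hw⟩, ?_⟩
    simp only [Subtype.mk.injEq]
    exact toSetoid_congr hwh

lemma dyck_even {n : ℕ} {h : ℕ → ℕ} (H : IsDyck n h) : n % 2 = 0 := by
  have : ∀ i, i ≤ n → h i % 2 = i % 2 := by
    intro i
    induction i with
    | zero => intro _; rw [H.zero]
    | succ i ih =>
      intro hi
      have := ih (by omega)
      have := H.step i (by omega)
      omega
  have := this n le_rfl
  rw [H.last] at this
  omega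

end CycleDT

/-- The number of partitions `π` of the vertices of the directed
`2m`-cycle whose quotient graph is a double tree is the `m`-th Catalan number
`(2m choose m)/(m+1)`; for an odd cycle, no quotient is a double tree. -/
theorem card_doubleTree_quotients_of_cycle (m : ℕ) (hm : 0 < m) :
    Nat.card {π : Setoid (Fin (2 * m)) //
        ((cycleGraph (2 * m) (by omega)).quot π).IsDoubleTree}
      = (2 * m).choose m / (m + 1) ∧
    ∀ π : Setoid (Fin (2 * m + 1)),
      ¬ ((cycleGraph (2 * m + 1) (by omega)).quot π).IsDoubleTree := by
  refine ⟨?_, fun π hπ => ?_⟩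
  · rw [CycleDT.card_eq m, catalan_eq_centralBinom_div, Nat.centralBinom]
  · obtain ⟨h, H, -⟩ := CycleDT.exists_dyck _ π hπ
    have := CycleDT.dyck_even H
    omega
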